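/- Let n ≥ 2, let A ∈ ℂ^{n×n} be a matrix which is not a scalar multiple of the identity, and let C ∈ ℂ^{n×n} be arbitrary. Then there exists a Hermitian matrix B ∈ ℂ^{n×n} (B* = B) such that the unital subalgebra of ℂ^{n×n} generated by A and B + C is all of ℂ^{n×n}. -/

import Mathlib

open Matrix

/-- The nilpotent matrix with ones on the superdiagonal and zeros elsewhere. -/
def superdiagonal (n : ℕ) (R : Type*) [Zero R] [One R] : Matrix (Fin n) (Fin n) R :=
  Matrix.of fun i j => if (i : ℕ) + 1 = j then 1 else 0

theorem superdiagonal_pow_apply {R : Type*} [CommRing R] {n : ℕ} (k : ℕ) (i j : Fin n) :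
    (superdiagonal n R ^ k) i j = if (i : ℕ) + k = j then 1 else 0 := by
  induction k generalizing j with
  | zero => simp [Matrix.one_apply, Fin.ext_iff]
  | succ k ih =>
    rw [pow_succ, Matrix.mul_apply]
    simp only [ih, ite_mul, one_mul, zero_mul]
    simp only [superdiagonal, Matrix.of_apply]
    by_cases h : (i : ℕ) + k < n
    · rw [Finset.sum_eq_single ⟨i + k, h⟩]
      · simp [add_assoc]
      · intro b _ hb
        rw [if_neg]
        intro h'
        exact hb (Fin.ext h'.symm)
      · simp
    · rw [Finset.sum_eq_zero]
      · rw [if_neg]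
        omega
      · intro x _
        rw [if_neg]
        omega

theorem vecMul_superdiagonal_zero {R : Type*} [CommRing R] {n : ℕ} (w : Fin (n + 1) → R) :
    (w ᵥ* superdiagonal (n + 1) R) 0 = 0 := by
  simp [Matrix.vecMul, dotProduct, superdiagonal]

theorem vecMul_superdiagonal_succ {R : Type*} [CommRing R] {n : ℕ} (w : Fin (n + 1) → R)
    (k : Fin n) : (w ᵥ* superdiagonal (n + 1) R) k.succ = w k.castSucc := by
  simp only [Matrix.vecMul, dotProduct, superdiagonal, Matrix.of_apply]
  rw [Finset.sum_eq_single k.castSucc]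
  · simp
  · intro b _ hb
    rw [if_neg, mul_zero]
    intro h
    apply hb
    ext
    simpa using h
  · simp

/-- A submodule containing, for every `k`, a vector whose first nonzero entry is a `1` in
position `k` is everything. -/
theorem Submodule.eq_top_of_exists_echelon {R : Type*} [CommRing R] {n : ℕ}
    (W : Submodule R (Fin n → R))
    (h : ∀ k, ∃ w ∈ W, w k = 1 ∧ ∀ j < k, w j = 0) : W = ⊤ := by
  have key : ∀ d : ℕ, ∀ x : Fin n → R, (∀ j : Fin n, (j : ℕ) + d < n → x j = 0) → x ∈ W := by
    intro d
    induction d with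
    | zero =>
      intro x hx
      have : x = 0 := funext fun j => hx j (by simp)
      simp [this]
    | succ d ih =>
      intro x hx
      by_cases hd : d < n
      · obtain ⟨w, hw, hw1, hw0⟩ := h ⟨n - 1 - d, by omega⟩
        have hmem : x - x ⟨n - 1 - d, by omega⟩ • w ∈ W := by
          apply ih
          intro j hj
          by_cases hj' : (j : ℕ) = n - 1 - d
          · have hj'' : j = ⟨n - 1 - d, by omega⟩ := Fin.ext hj'
            simp [hj'', hw1]
          · have h1 : x j = 0 := hx j (by omega)
            have h2 : w j = 0 := hw0 j (by rw [Fin.lt_def]; simp only; omega)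
            simp [h1, h2]
        simpa using W.add_mem hmem (W.smul_mem (x ⟨n - 1 - d, by omega⟩) hw)
      · exact ih x fun j hj => by omega
  exact (Submodule.eq_top_iff').2 fun x => key n x fun j hj => by omega

theorem adjoin_superdiagonal_eq_top {R : Type*} [CommRing R] {m : ℕ}
    (A : Matrix (Fin (m + 2)) (Fin (m + 2)) R)
    (hA : A.col 0 = Pi.single (Fin.last (m + 1)) 1) :
    Algebra.adjoin R {A, superdiagonal (m + 2) R} = ⊤ := by
  set N := superdiagonal (m + 2) R with hN
  set S := Algebra.adjoin R {A, N} with hS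
  have hAS : A ∈ S := Algebra.subset_adjoin (by simp)
  have hNS : N ∈ S := Algebra.subset_adjoin (by simp)
  have hcorner : Matrix.single 0 (Fin.last (m + 1)) (1 : R) = N ^ (m + 1) := by
    ext i j
    rw [hN, superdiagonal_pow_apply, Matrix.single_apply]
    congr 1
    simp only [Fin.ext_iff, Fin.val_zero, Fin.val_last, eq_iff_iff]
    omega
  have hlast : ∀ i, Matrix.single i (Fin.last (m + 1)) (1 : R) ∈ S := by
    intro i
    induction i using Fin.reverseInduction with
    | last =>
      have : Matrix.single (Fin.last (m + 1)) (Fin.last (m + 1)) (1 : R) = A * N ^ (m + 1) := by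
        rw [← hcorner, Matrix.single_eq_single_vecMulVec_single,
          Matrix.single_eq_single_vecMulVec_single, Matrix.mul_vecMulVec,
          Matrix.mulVec_single_one, hA]
      rw [this]
      exact S.mul_mem hAS (S.pow_mem hNS _)
    | cast i ih =>
      have : Matrix.single i.castSucc (Fin.last (m + 1)) (1 : R)
          = N * Matrix.single i.succ (Fin.last (m + 1)) 1 := by
        rw [Matrix.single_eq_single_vecMulVec_single,
          Matrix.single_eq_single_vecMulVec_single, Matrix.mul_vecMulVec,
          Matrix.mulVec_single_one]
        congr 1
        ext j
        simp [hN, superdiagonal, Pi.single_apply, Fin.ext_iff]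
      rw [this]
      exact S.mul_mem hNS ih
  let W : Submodule R (Fin (m + 2) → R) :=
    { carrier := {w | ∀ i, Matrix.vecMulVec (Pi.single i 1) w ∈ S}
      add_mem' := fun ha hb i => by
        rw [Matrix.vecMulVec_add]
        exact S.add_mem (ha i) (hb i)
      zero_mem' := fun i => by
        rw [Matrix.vecMulVec_zero]
        exact S.zero_mem
      smul_mem' := fun c w hw i => by
        rw [Matrix.vecMulVec_smul]
        exact S.smul_mem (hw i) c }
  have hW : W = ⊤ := by
    apply Submodule.eq_top_of_exists_echelon
    intro k
    induction k using Fin.induction with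
    | zero =>
      refine ⟨A.row (Fin.last (m + 1)), fun i => ?_, ?_, fun j hj => absurd hj (Fin.not_lt_zero j)⟩
      · have := S.mul_mem (hlast i) hAS
        rwa [Matrix.single_eq_single_vecMulVec_single, Matrix.vecMulVec_mul,
          Matrix.single_one_vecMul] at this
      · exact (congrFun hA _).trans (Pi.single_eq_same _ _)
    | succ k ih =>
      obtain ⟨w, hw, hw1, hw0⟩ := ih
      refine ⟨w ᵥ* N, fun i => ?_, ?_, fun j hj => ?_⟩
      · rw [← Matrix.vecMulVec_mul]
        exact S.mul_mem (hw i) hNS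
      · rw [hN, vecMul_superdiagonal_succ, hw1]
      · cases j using Fin.cases with
        | zero => exact vecMul_superdiagonal_zero w
        | succ j =>
          rw [hN, vecMul_superdiagonal_succ]
          exact hw0 _ (Fin.succ_lt_succ_iff.1 hj)
  rw [eq_top_iff]
  intro X _
  rw [Matrix.matrix_eq_sum_single X]
  refine S.sum_mem fun i _ => S.sum_mem fun j _ => ?_
  have : Pi.single j (1 : R) ∈ W := hW ▸ Submodule.mem_top
  have h := S.smul_mem (this i) (X i j)
  rwa [← Matrix.single_eq_single_vecMulVec_single, Matrix.smul_single, smul_eq_mul,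
    mul_one] at h

theorem LinearIndependent.exists_basis_fin {K V : Type*} [Field K] [AddCommGroup V] [Module K V]
    {m : ℕ} (hV : Module.finrank K V = m + 2) {v w : V} (h : LinearIndependent K ![v, w]) :
    ∃ b : Module.Basis (Fin (m + 2)) K V, b 0 = v ∧ b (Fin.last (m + 1)) = w := by
  classical
  have : Module.Finite K V := Module.finite_of_finrank_pos (by omega)
  let b := Module.Basis.sumExtend h
  have hb : ∀ i, b (Sum.inl i) = ![v, w] i := fun i => by
    simp [b, Module.Basis.sumExtend]
    rfl
  let e : _ ≃ Fin (m + 2) := b.indexEquiv (Module.finBasisOfFinrankEq K V hV)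
  let e₁ := e.trans (Equiv.swap (e (Sum.inl 0)) 0)
  let e₂ := e₁.trans (Equiv.swap (e₁ (Sum.inl 1)) (Fin.last (m + 1)))
  have h0 : e₁ (Sum.inl 0) = 0 := by simp [e₁]
  have h1 : e₂ (Sum.inl 1) = Fin.last (m + 1) := by simp [e₂]
  have h2 : e₂ (Sum.inl 0) = 0 := by
    have hne : (0 : Fin (m + 2)) ≠ e₁ (Sum.inl 1) := by
      rw [← h0]
      simp
    simp only [e₂, Equiv.trans_apply, h0]
    exact Equiv.swap_apply_of_ne_of_ne hne (by simp [Fin.ext_iff])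
  refine ⟨b.reindex e₂, ?_, ?_⟩
  · rw [Module.Basis.reindex_apply, ← h2, Equiv.symm_apply_apply, hb]
    rfl
  · rw [Module.Basis.reindex_apply, ← h1, Equiv.symm_apply_apply, hb]
    rfl

theorem Module.End.exists_adjoin_pair_eq_top {K V : Type*} [Field K] [AddCommGroup V] [Module K V]
    (hV : 2 ≤ Module.finrank K V) (f : Module.End K V) (hf : ¬ ∃ c : K, f = c • 1) :
    ∃ g : Module.End K V, Algebra.adjoin K {f, g} = ⊤ := by
  obtain ⟨m, hm⟩ := Nat.exists_eq_add_of_le' hV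
  obtain ⟨v, hv⟩ : ∃ v, LinearIndependent K ![v, f v] := by
    by_contra! h
    exact hf (LinearMap.exists_eq_smul_id_of_forall_notLinearIndependent h)
  obtain ⟨b, hb0, hb1⟩ := hv.exists_basis_fin hm
  let φ := LinearMap.toMatrixAlgEquiv b
  have h := adjoin_superdiagonal_eq_top (φ f) (by
    ext i
    simp [φ, LinearMap.toMatrixAlgEquiv_apply, hb0, ← hb1, Finsupp.single_apply, Pi.single_apply,
      eq_comm])
  refine ⟨φ.symm (superdiagonal (m + 2) K), ?_⟩
  have h' := congrArg (Subalgebra.map φ.symm.toAlgHom) h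
  rw [AlgHom.map_adjoin, Set.image_pair, Algebra.map_top,
    (AlgHom.range_eq_top _).2 φ.symm.surjective] at h'
  simpa using h'

theorem Matrix.exists_adjoin_pair_eq_top {K : Type*} [Field K] {n : ℕ} (hn : 2 ≤ n)
    (A : Matrix (Fin n) (Fin n) K) (hA : ¬ ∃ c : K, A = c • 1) :
    ∃ M : Matrix (Fin n) (Fin n) K, Algebra.adjoin K {A, M} = ⊤ := by
  let φ := Matrix.toLinAlgEquiv' (R := K) (n := Fin n)
  obtain ⟨g, hg⟩ := Module.End.exists_adjoin_pair_eq_top (by simpa using hn) (φ A) (by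
    rintro ⟨c, hc⟩
    exact hA ⟨c, φ.injective (by rw [hc, map_smul, map_one])⟩)
  refine ⟨φ.symm g, ?_⟩
  have h := congrArg (Subalgebra.map φ.symm.toAlgHom) hg
  rw [AlgHom.map_adjoin, Set.image_pair, Algebra.map_top,
    (AlgHom.range_eq_top _).2 φ.symm.surjective] at h
  simpa using h

/-- If the members of a polynomial family of matrices generate the full matrix algebra at one
parameter, they do so at all but finitely many parameters. -/
theorem Matrix.finite_setOf_adjoin_eval_ne_top {K ι : Type*} [Field K] [Fintype ι] [DecidableEq ι]
    (s : Set (Matrix ι ι (Polynomial K))) (z : K)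
    (hz : Algebra.adjoin K ((Polynomial.aeval z).mapMatrix '' s) = (⊤ : Subalgebra K _)) :
    {t : K | Algebra.adjoin K ((Polynomial.aeval t).mapMatrix '' s) ≠
      (⊤ : Subalgebra K (Matrix ι ι K))}.Finite := by
  have hex : ∀ p : ι × ι, ∃ b ∈ Algebra.adjoin K s,
      (Polynomial.aeval z).mapMatrix b = Matrix.single p.1 p.2 (1 : K) := by
    intro p
    rw [← AlgHom.map_adjoin] at hz
    have : Matrix.single p.1 p.2 (1 : K) ∈ (⊤ : Subalgebra K (Matrix ι ι K)) := Algebra.mem_top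
    rwa [← hz, Subalgebra.mem_map] at this
  choose b hb hbz using hex
  let G : Matrix (ι × ι) (ι × ι) (Polynomial K) := Matrix.of fun p q => b p q.1 q.2
  have hdet : ∀ t : K, G.det.eval t = ((Polynomial.aeval t).mapMatrix G).det := by
    intro t
    rw [← AlgHom.map_det, Polynomial.coe_aeval_eq_eval]
  have hne : G.det ≠ 0 := by
    intro h0
    have h1 : (Polynomial.aeval z).mapMatrix G = (1 : Matrix (ι × ι) (ι × ι) K) := by
      ext p q
      have := congrFun (congrFun (hbz p) q.1) q.2
      simp only [AlgHom.mapMatrix_apply, Matrix.map_apply] at this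
      simp only [AlgHom.mapMatrix_apply, Matrix.map_apply, G, Matrix.of_apply, this,
        Matrix.single_apply, Matrix.one_apply, Prod.ext_iff]
    have h2 := hdet z
    rw [h0, h1] at h2
    simp at h2
  refine (Polynomial.finite_setOfPred_isRoot hne).subset fun t ht => ?_
  by_contra hroot
  apply ht
  rw [← AlgHom.map_adjoin, eq_top_iff]
  intro X _
  set H := (Polynomial.aeval t).mapMatrix G with hH
  have hunit : IsUnit H.det := by
    rw [← hdet]
    exact isUnit_iff_ne_zero.2 hroot
  let c : ι × ι → K := (fun q => X q.1 q.2) ᵥ* H⁻¹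
  have hc : c ᵥ* H = fun q => X q.1 q.2 := by
    simp only [c]
    rw [Matrix.vecMul_vecMul, Matrix.nonsing_inv_mul _ hunit, Matrix.vecMul_one]
  have hX : X = ∑ p, c p • (Polynomial.aeval t).mapMatrix (b p) := by
    ext i j
    have := congrFun hc (i, j)
    simp only at this
    rw [← this]
    simp [Matrix.vecMul, dotProduct, hH, G, Matrix.sum_apply]
  rw [hX]
  exact Subalgebra.sum_mem _ fun p _ => Subalgebra.smul_mem _
    (Subalgebra.mem_map.2 ⟨b p, hb p, rfl⟩) _

/-- If `A ∈ ℂ^{n×n}` (`n ≥ 2`) is not a scalar multiple of the identity and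
`C` is arbitrary, then there is a Hermitian matrix `B` such that the unital subalgebra
generated by `A` and `B + C` is all of `ℂ^{n×n}`. -/
theorem generate_matrix_algebra_shifted {n : ℕ} (hn : 2 ≤ n)
    (A C : Matrix (Fin n) (Fin n) ℂ)
    (hA : ¬ ∃ c : ℂ, A = c • (1 : Matrix (Fin n) (Fin n) ℂ)) :
    ∃ B : Matrix (Fin n) (Fin n) ℂ, B.IsHermitian ∧
      Algebra.adjoin ℂ ({A, B + C} : Set (Matrix (Fin n) (Fin n) ℂ)) = ⊤ := by
  obtain ⟨M, hM⟩ := Matrix.exists_adjoin_pair_eq_top hn A hA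
  let H : Matrix (Fin n) (Fin n) ℂ := realPart (M - C)
  let K : Matrix (Fin n) (Fin n) ℂ := imaginaryPart (M - C)
  have hH : H.IsHermitian := (realPart (M - C)).2
  have hK : K.IsHermitian := (imaginaryPart (M - C)).2
  have hHK : H + Complex.I • K = M - C := realPart_add_I_smul_imaginaryPart (M - C)
  let s : Set (Matrix (Fin n) (Fin n) (Polynomial ℂ)) :=
    {A.map Polynomial.C,
      (H + C).map Polynomial.C + (Polynomial.X : Polynomial ℂ) • K.map Polynomial.C}
  have hs : ∀ z : ℂ, (Polynomial.aeval z).mapMatrix '' s = {A, (H + z • K) + C} := by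
    intro z
    rw [Set.image_pair]
    congr 1
    · ext i j
      simp
    · congr 1
      ext i j
      simp
      ring
  have hfin := Matrix.finite_setOf_adjoin_eval_ne_top s Complex.I (by
    rw [hs, hHK, sub_add_cancel, hM])
  obtain ⟨_, ⟨t, rfl⟩, ht⟩ :=
    (Set.infinite_range_of_injective Complex.ofReal_injective).exists_notMem_finite hfin
  rw [Set.mem_ofPred_eq, not_not, hs] at ht
  refine ⟨H + (t : ℂ) • K, hH.add ?_, ht⟩
  rw [Matrix.IsHermitian, Matrix.conjTranspose_smul, hK.eq]
  simp
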